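/- arXiv:math/0411571 — 3 statements merged into one kernel-verified Lean document; each statement's English description precedes it below -/
import Mathlib

section
/- Let p be an odd prime. In the polynomial ring F_p[x,y] over the field with p elements, the following identity holds: x·y·(y − x)·(Σ_{k=0}^{p−3} a_k · x^k · y^{p−3−k}) = Σ_{i=1}^{p−1} (i⁻¹) · x^i · y^{p−i}, where a_k = Σ_{j=0}^{k} (j+1)⁻¹ and the inverses are taken in F_p = Z/pZ. -/
open MvPolynomial Finset

/-- Summation by parts for homogeneous sums in two ring elements. -/
theorem sub_mul_sum_partialSums_add {R : Type*} [CommRing R] (b : ℕ → R) (x y : R) (n : ℕ) :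
    (y - x) * ∑ k ∈ range n, (∑ j ∈ range (k + 1), b j) * x ^ k * y ^ (n - 1 - k)
        + (∑ j ∈ range (n + 1), b j) * x ^ n
      = ∑ k ∈ range (n + 1), b k * x ^ k * y ^ (n - k) := by
  induction n with
  | zero => simp
  | succ n ih =>
    have hleft : ∑ k ∈ range n, (∑ j ∈ range (k + 1), b j) * x ^ k * y ^ (n + 1 - 1 - k)
        = y * ∑ k ∈ range n, (∑ j ∈ range (k + 1), b j) * x ^ k * y ^ (n - 1 - k) := by
      rw [mul_sum]
      refine sum_congr rfl fun k hk => ?_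
      rw [show n + 1 - 1 - k = n - 1 - k + 1 by have := mem_range.1 hk; omega]
      ring
    have hright : ∑ k ∈ range (n + 1), b k * x ^ k * y ^ (n + 1 - k)
        = y * ∑ k ∈ range (n + 1), b k * x ^ k * y ^ (n - k) := by
      rw [mul_sum]
      refine sum_congr rfl fun k hk => ?_
      rw [show n + 1 - k = n - k + 1 by have := mem_range.1 hk; omega]
      ring
    rw [sum_range_succ _ n, hleft, sum_range_succ _ (n + 1), sum_range_succ _ (n + 1), hright, ← ih]
    simp only [Nat.add_sub_cancel, Nat.sub_self]
    ring

/-- The harmonic number `H_(p-1)` vanishes modulo an odd prime `p`. -/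
theorem ZMod.sum_range_inv_add_one_eq_zero (p : ℕ) (hp : p.Prime) (hodd : Odd p) :
    ∑ j ∈ range (p - 1), ((j : ZMod p) + 1)⁻¹ = 0 := by
  have := Fact.mk hp
  have hneg : ∑ j ∈ range (p - 1), ((j : ZMod p) + 1)⁻¹
      = -∑ j ∈ range (p - 1), ((j : ZMod p) + 1)⁻¹ := by
    conv_lhs => rw [← sum_range_reflect]
    rw [← sum_neg_distrib]
    refine sum_congr rfl fun j hj => ?_
    rw [← inv_neg]
    congr 1
    have hsum : p - 1 - 1 - j + 1 + (j + 1) = p := by have := mem_range.1 hj; omega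
    have hcast := congrArg (Nat.cast : ℕ → ZMod p) hsum
    push_cast [CharP.cast_eq_zero] at hcast
    exact eq_neg_of_add_eq_zero_left hcast
  exact (ZMod.neg_eq_self_iff _).1 hneg.symm |>.resolve_right fun h => by
    obtain ⟨m, hm⟩ := hodd
    omega

/-- For an odd prime `p`, in `F_p[x,y]` (with `x = X 0`, `y = X 1`):
`x·y·(y-x)·(Σ_{k=0}^{p-3} a_k x^k y^(p-3-k)) = Σ_{i=1}^{p-1} i⁻¹ x^i y^(p-i)`,
where `a_k = Σ_{j=0}^{k} (j+1)⁻¹` in `F_p`. -/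
theorem stmt2 (p : ℕ) (hp : p.Prime) (hodd : Odd p) :
    (X 0 : MvPolynomial (Fin 2) (ZMod p)) * X 1 * (X 1 - X 0) *
        ∑ k ∈ Finset.range (p - 2),
          C (∑ j ∈ Finset.range (k + 1), ((j : ZMod p) + 1)⁻¹) * X 0 ^ k * X 1 ^ (p - 3 - k)
      = ∑ i ∈ Finset.Ico 1 p, C ((i : ZMod p))⁻¹ * X 0 ^ i * X 1 ^ (p - i) := by
  have hparts := sub_mul_sum_partialSums_add
    (fun j => C ((j : ZMod p) + 1)⁻¹) (X 0 : MvPolynomial (Fin 2) (ZMod p)) (X 1) (p - 2)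
  have hp2 : p - 2 + 1 = p - 1 := by have := hp.two_le; omega
  simp only [← map_sum, hp2, ZMod.sum_range_inv_add_one_eq_zero p hp hodd, map_zero, zero_mul,
    add_zero, show p - 2 - 1 = p - 3 by omega] at hparts
  rw [mul_assoc, hparts, sum_Ico_eq_sum_range, mul_sum]
  refine sum_congr rfl fun k hk => ?_
  rw [show p - (1 + k) = p - 2 - k + 1 by have := mem_range.1 hk; omega, Nat.cast_add,
    Nat.cast_one, add_comm (1 : ZMod p)]
  ring
end

section
/- Let F_2 be the field with two elements, and for n ≥ 0 let C_n = F_2[x, y_1, …, y_n] be the polynomial ring. For 0 ≤ i ≤ n let d_i : C_n → C_{n−1} be the F_2-algebra homomorphism determined by d_i(x) = x and d_i(y_j) = x² if i = 0 and j = 1; d_i(y_j) = y_{j−1} if i < j and j > 1; d_i(y_j) = y_j if i ≥ j and j < n; d_i(y_j) = 0 if i = j = n. Define ∂_n : C_n → C_{n−1} as ∂_n = Σ_{i=0}^{n} d_i (no signs are needed in characteristic 2). Then (C_•, ∂) is a chain complex (∂_n ∘ ∂_{n+1} = 0), the quotient map C_0 = F_2[x] → F_2[x]/(x²) induces an isomorphism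 H_0(C) ≅ F_2[x]/(x²), and H_n(C) = 0 for all n ≥ 1. -/
open MvPolynomial

/-- The chain groups `C_n = F₂[x, y₁, …, y_n]`, realized as polynomials in the
variables `Fin (n+1)`, where the variable `0` is `x` and the variable `j ≥ 1` is `y_j`. -/
noncomputable abbrev resObj (n : ℕ) : Type :=
  MvPolynomial (Fin (n + 1)) (ZMod 2)

/-- The face map `d_i : C_{n+1} → C_n` determined by `d_i(x) = x` and
`d_i(y_j) = x²` if `i = 0, j = 1`; `y_{j-1}` if `i < j, j > 1`; `y_j` if `i ≥ j, j < n+1`;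
`0` if `i = j = n+1`. -/
noncomputable def faceMap (n i : ℕ) : resObj (n + 1) →ₐ[ZMod 2] resObj n :=
  MvPolynomial.aeval fun v : Fin (n + 2) =>
    if v.val = 0 then MvPolynomial.X 0
    else if i = 0 ∧ v.val = 1 then MvPolynomial.X 0 ^ 2
    else if i < v.val then MvPolynomial.X ⟨v.val - 1, by have := v.isLt; omega⟩
    else if h : v.val < n + 1 then MvPolynomial.X ⟨v.val, h⟩
    else 0

/-- The boundary map `∂_{n+1} = Σ_{i=0}^{n+1} d_i : C_{n+1} → C_n`
(no signs are needed in characteristic 2). -/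
noncomputable def bdry (n : ℕ) : resObj (n + 1) →ₗ[ZMod 2] resObj n :=
  ∑ i ∈ Finset.range (n + 2), (faceMap n i).toLinearMap

/-- The face maps satisfy the simplicial identity `d_i d_{j+1} = d_j d_i` for `i ≤ j`. -/
lemma faceMap_comp_faceMap (n i j : ℕ) (hij : i ≤ j) (hj : j ≤ n + 1) :
    (faceMap n i).comp (faceMap (n + 1) (j + 1)) =
      (faceMap n j).comp (faceMap (n + 1) i) := by
  refine MvPolynomial.algHom_ext fun v => ?_
  obtain ⟨v, hv⟩ := v
  simp only [faceMap, AlgHom.comp_apply, aeval_X, Nat.add_one_ne_zero, false_and, if_false]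
  split_ifs <;> (try simp only [aeval_X, map_pow, map_zero, Fin.val_zero, if_true]) <;>
    (try split_ifs) <;> first | (exfalso; omega) | with_reducible rfl

lemma bdry_comp_bdry (n : ℕ) : (bdry n).comp (bdry (n + 1)) = 0 := by
  refine LinearMap.ext fun p => ?_
  simp only [bdry, LinearMap.comp_apply, LinearMap.sum_apply, map_sum,
    AlgHom.toLinearMap_apply, LinearMap.zero_apply]
  rw [Finset.sum_comm, ← Finset.sum_product']
  have key : ∀ i j, i ≤ j → j ≤ n + 1 → faceMap n i (faceMap (n + 1) (j + 1) p) =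
      faceMap n j (faceMap (n + 1) i p) := fun i j hij hj =>
    DFunLike.congr_fun (faceMap_comp_faceMap n i j hij hj) p
  refine Finset.sum_involution
    (fun a _ => if a.1 < a.2 then (a.2 - 1, a.1) else (a.2, a.1 + 1)) ?_ ?_ ?_ ?_
  · rintro ⟨i, j⟩ h
    simp only [Finset.mem_product, Finset.mem_range] at h
    by_cases hij : i < j
    · obtain ⟨k, rfl⟩ : ∃ k, j = k + 1 := ⟨j - 1, by omega⟩
      simp only [hij, if_true, Nat.add_sub_cancel]
      rw [key i k (by omega) (by omega)]
      exact CharTwo.add_self_eq_zero _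
    · simp only [hij, if_false]
      rw [key j i (by omega) (by omega)]
      exact CharTwo.add_self_eq_zero _
  · rintro ⟨i, j⟩ h _
    split_ifs <;> grind
  · rintro ⟨i, j⟩ h
    simp only [Finset.mem_product, Finset.mem_range] at h ⊢
    split_ifs <;> grind
  · rintro ⟨i, j⟩ h
    grind

lemma range_bdry_zero :
    LinearMap.range (bdry 0) = Submodule.restrictScalars (ZMod 2)
      (Ideal.span {(X 0 : resObj 0) ^ 2}) := by
  have hb : ∀ p, bdry 0 p = faceMap 0 0 p + faceMap 0 1 p := fun p => by
    simp [bdry, Finset.sum_range_succ]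
  ext q
  simp only [LinearMap.mem_range, Submodule.restrictScalars_mem]
  constructor
  · rintro ⟨p, rfl⟩
    have hcongr : (Ideal.Quotient.mkₐ (ZMod 2) (Ideal.span {(X 0 : resObj 0) ^ 2})).comp
        (faceMap 0 0) =
        (Ideal.Quotient.mkₐ (ZMod 2) (Ideal.span {(X 0 : resObj 0) ^ 2})).comp
          (faceMap 0 1) := by
      refine MvPolynomial.algHom_ext fun v => ?_
      fin_cases v
      · simp [faceMap]
      · simp only [faceMap, AlgHom.comp_apply, aeval_X]
        simp only [Ideal.Quotient.mkₐ_eq_mk]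
        simp [-map_pow]
    rw [hb, ← CharTwo.sub_eq_add, ← Ideal.Quotient.eq]
    exact DFunLike.congr_fun hcongr p
  · intro hq
    obtain ⟨r, rfl⟩ := Ideal.mem_span_singleton.mp hq
    refine ⟨X 1 * rename Fin.castSucc r, ?_⟩
    have h0 : (faceMap 0 0).comp (rename Fin.castSucc) = AlgHom.id (ZMod 2) (resObj 0) := by
      refine MvPolynomial.algHom_ext fun v => ?_
      fin_cases v
      simp [faceMap]
    have h0r : faceMap 0 0 (rename Fin.castSucc r) = r := DFunLike.congr_fun h0 r
    rw [hb, map_mul, map_mul, h0r]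
    simp [faceMap]

/-- The substitution `x ↦ x²`, `y_j ↦ y_j`. -/
noncomputable def squareFirst (n : ℕ) : resObj n →ₐ[ZMod 2] resObj n :=
  aeval fun v => if v = 0 then X 0 ^ 2 else X v

/-- The face maps of the bar construction in which `x` and `y₁` are multiplied
without squaring, so that `d_0(y₁) = x`. -/
noncomputable def barFace (n i : ℕ) : resObj (n + 1) →ₐ[ZMod 2] resObj n :=
  aeval fun v : Fin (n + 2) =>
    if v.val = 0 then X 0
    else if i < v.val then X ⟨v.val - 1, by have := v.isLt; omega⟩
    else if h : v.val < n + 1 then X ⟨v.val, h⟩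
    else 0

/-- The effect of the extra degeneracy on exponents:
`x^(2k+e) y₁^(a₁) ⋯ ↦ x^e y₁^k y₂^(a₁) ⋯` for `e < 2`. -/
noncomputable def splitExponent {n : ℕ} (m : Fin (n + 1) →₀ ℕ) : Fin (n + 2) →₀ ℕ :=
  Finsupp.cons (m 0 % 2) (Finsupp.cons (m 0 / 2) m.tail)

/-- The extra degeneracy, a contracting homotopy of the resolution. -/
noncomputable def extraDegeneracy (n : ℕ) : resObj n →ₗ[ZMod 2] resObj (n + 1) :=
  (basisMonomials (Fin (n + 1)) (ZMod 2)).constr (ZMod 2)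
    fun m => monomial (splitExponent m) 1

lemma extraDegeneracy_monomial (n : ℕ) (m : Fin (n + 1) →₀ ℕ) :
    extraDegeneracy n (monomial m 1) = monomial (splitExponent m) 1 := by
  have h := (basisMonomials (Fin (n + 1)) (ZMod 2)).constr_basis (ZMod 2)
    (fun m => (monomial (splitExponent m) 1 : resObj (n + 1))) m
  rwa [coe_basisMonomials] at h

lemma monomial_eq_prod {n : ℕ} (m : Fin (n + 1) →₀ ℕ) :
    (monomial m 1 : resObj n) = X 0 ^ m 0 * ∏ j : Fin n, X j.succ ^ m j.succ := by
  rw [monomial_eq, Finsupp.prod_fintype _ _ (by simp), Fin.prod_univ_succ]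
  simp

lemma monomial_splitExponent {n : ℕ} (m : Fin (n + 1) →₀ ℕ) :
    (monomial (splitExponent m) 1 : resObj (n + 1)) =
      X 0 ^ (m 0 % 2) * (X 1 ^ (m 0 / 2) * ∏ j : Fin n, X j.succ.succ ^ m j.succ) := by
  rw [monomial_eq_prod, Fin.prod_univ_succ]
  rw [splitExponent, Finsupp.cons_zero, Finsupp.cons_succ, Finsupp.cons_zero]
  simp [Finsupp.cons_succ, Finsupp.tail_apply]

lemma squareFirst_monomial {n : ℕ} (m : Fin (n + 1) →₀ ℕ) :
    squareFirst n (monomial m 1) = X 0 ^ (2 * m 0) * ∏ j : Fin n, X j.succ ^ m j.succ := by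
  rw [monomial_eq_prod]
  simp [squareFirst, map_prod, Fin.succ_ne_zero, pow_mul]

lemma extraDegeneracy_X_pow_mul_squareFirst (n e : ℕ) (he : e < 2) (p : resObj n) :
    extraDegeneracy n (X 0 ^ e * squareFirst n p) = X 0 ^ e * rename Fin.succ p := by
  have h : (extraDegeneracy n).comp
        ((LinearMap.mulLeft (ZMod 2) (X 0 ^ e)).comp (squareFirst n).toLinearMap) =
      (LinearMap.mulLeft (ZMod 2) (X 0 ^ e)).comp (rename Fin.succ).toLinearMap := by
    refine (basisMonomials (Fin (n + 1)) (ZMod 2)).ext fun m => ?_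
    simp only [coe_basisMonomials, LinearMap.comp_apply, AlgHom.toLinearMap_apply,
      LinearMap.mulLeft_apply]
    have hm : (X 0 ^ e * squareFirst n (monomial m 1) : resObj n) =
        monomial (Finsupp.cons (e + 2 * m 0) m.tail) 1 := by
      rw [squareFirst_monomial, monomial_eq_prod]
      simp [Finsupp.cons_succ, Finsupp.tail_apply, pow_add, mul_assoc]
    rw [hm, extraDegeneracy_monomial, monomial_splitExponent, monomial_eq_prod]
    have h1 : (e + 2 * m 0) % 2 = e := by omega
    have h2 : (e + 2 * m 0) / 2 = m 0 := by omega
    simp [Finsupp.cons_succ, Finsupp.tail_apply, map_prod, h1, h2]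
  exact DFunLike.congr_fun h p

/-- Every polynomial splits into its parts of even and odd degree in `x`. -/
lemma exists_squareFirst_add (n : ℕ) (p : resObj n) :
    ∃ q r : resObj n, p = X 0 ^ 0 * squareFirst n q + X 0 ^ 1 * squareFirst n r := by
  induction p using MvPolynomial.induction_on with
  | C a => exact ⟨C a, 0, by simp [squareFirst]⟩
  | add p p' hp hp' =>
    obtain ⟨q, r, rfl⟩ := hp
    obtain ⟨q', r', rfl⟩ := hp'
    exact ⟨q + q', r + r', by simp only [map_add]; ring⟩
  | mul_X p v hp =>
    obtain ⟨q, r, rfl⟩ := hp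
    by_cases hv : v = 0
    · subst hv
      refine ⟨X 0 * r, q, ?_⟩
      have : squareFirst n (X 0) = X 0 ^ 2 := by simp [squareFirst]
      rw [map_mul, this]
      ring
    · refine ⟨q * X v, r * X v, ?_⟩
      have : squareFirst n (X v) = X v := by simp [squareFirst, hv]
      rw [map_mul, map_mul, this]
      ring

lemma faceMap_X_zero (n i : ℕ) : faceMap n i (X 0) = X 0 := by
  simp [faceMap]

lemma faceMap_comp_squareFirst (n i : ℕ) :
    (faceMap n i).comp (squareFirst (n + 1)) = (squareFirst n).comp (barFace n i) := by
  refine MvPolynomial.algHom_ext fun v => ?_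
  obtain ⟨v, hv⟩ := v
  simp only [faceMap, squareFirst, barFace, AlgHom.comp_apply, aeval_X, Fin.ext_iff, Fin.val_zero]
  split_ifs <;> (try simp only [aeval_X, map_pow, map_zero, Fin.val_zero]) <;>
    (try split_ifs) <;> first | rfl | (exfalso; grind)

lemma faceMap_succ_comp_rename (n i : ℕ) :
    (faceMap (n + 1) (i + 1)).comp (rename Fin.succ) =
      (rename Fin.succ).comp (barFace n i) := by
  refine MvPolynomial.algHom_ext fun v => ?_
  obtain ⟨v, hv⟩ := v
  simp only [faceMap, barFace, AlgHom.comp_apply, rename_X, aeval_X, Fin.val_succ]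
  split_ifs <;> (try simp only [rename_X, map_zero]) <;>
    first | rfl | (exfalso; grind) | (congr 1; ext; simp; omega)

lemma faceMap_zero_comp_rename (n : ℕ) :
    (faceMap n 0).comp (rename Fin.succ) = squareFirst n := by
  refine MvPolynomial.algHom_ext fun v => ?_
  obtain ⟨v, hv⟩ := v
  simp only [faceMap, squareFirst, AlgHom.comp_apply, rename_X, aeval_X, Fin.val_succ,
    Fin.ext_iff, Fin.val_zero]
  split_ifs <;> first | rfl | (exfalso; grind)

lemma faceMap_zero_extraDegeneracy (n : ℕ) (p : resObj n) :
    faceMap n 0 (extraDegeneracy n p) = p := by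
  have h : ∀ e < 2, ∀ q, faceMap n 0 (extraDegeneracy n (X 0 ^ e * squareFirst n q)) =
      X 0 ^ e * squareFirst n q := fun e he q => by
    rw [extraDegeneracy_X_pow_mul_squareFirst n e he, map_mul, map_pow, faceMap_X_zero,
      ← faceMap_zero_comp_rename, AlgHom.comp_apply]
  obtain ⟨q, r, rfl⟩ := exists_squareFirst_add n p
  rw [map_add, map_add, h 0 (by norm_num), h 1 (by norm_num)]

lemma faceMap_succ_extraDegeneracy (n i : ℕ) (p : resObj (n + 1)) :
    faceMap (n + 1) (i + 1) (extraDegeneracy (n + 1) p) =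
      extraDegeneracy n (faceMap n i p) := by
  have h : ∀ e < 2, ∀ q,
      faceMap (n + 1) (i + 1) (extraDegeneracy (n + 1) (X 0 ^ e * squareFirst (n + 1) q)) =
        extraDegeneracy n (faceMap n i (X 0 ^ e * squareFirst (n + 1) q)) := fun e he q => by
    rw [extraDegeneracy_X_pow_mul_squareFirst (n + 1) e he, map_mul, map_pow, faceMap_X_zero,
      map_mul, map_pow, faceMap_X_zero, ← AlgHom.comp_apply (faceMap n i),
      faceMap_comp_squareFirst, AlgHom.comp_apply,
      extraDegeneracy_X_pow_mul_squareFirst n e he,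
      ← AlgHom.comp_apply (faceMap (n + 1) (i + 1)), faceMap_succ_comp_rename,
      AlgHom.comp_apply]
  obtain ⟨q, r, rfl⟩ := exists_squareFirst_add (n + 1) p
  simp only [map_add] at h ⊢
  rw [h 0 (by norm_num), h 1 (by norm_num)]

/-- The extra degeneracy is a contracting homotopy in positive degrees. -/
lemma bdry_extraDegeneracy (n : ℕ) (p : resObj (n + 1)) :
    bdry (n + 1) (extraDegeneracy (n + 1) p) = extraDegeneracy n (bdry n p) + p := by
  simp only [bdry, LinearMap.sum_apply, AlgHom.toLinearMap_apply]
  rw [Finset.sum_range_succ', faceMap_zero_extraDegeneracy, map_sum]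
  simp only [faceMap_succ_extraDegeneracy]

/-- `(C_•, ∂)` is a chain complex; the quotient map
`C_0 = F₂[x] → F₂[x]/(x²)` induces an isomorphism `H_0(C) ≅ F₂[x]/(x²)`, i.e. the image
of `∂_1` is exactly the kernel `(x²)` of the quotient map; and `H_n(C) = 0` for `n ≥ 1`,
i.e. `ker ∂_n = im ∂_{n+1}`. -/
theorem stmt3 :
    (∀ n : ℕ, (bdry n).comp (bdry (n + 1)) = 0) ∧
    (LinearMap.range (bdry 0) =
      Submodule.restrictScalars (ZMod 2)
        (Ideal.span {(MvPolynomial.X 0 : resObj 0) ^ 2})) ∧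
    (∀ n : ℕ, LinearMap.ker (bdry n) = LinearMap.range (bdry (n + 1))) := by
  refine ⟨bdry_comp_bdry, range_bdry_zero, fun n => le_antisymm (fun p hp => ?_) ?_⟩
  · exact ⟨extraDegeneracy (n + 1) p, by
      rw [bdry_extraDegeneracy, LinearMap.mem_ker.mp hp, map_zero, zero_add]⟩
  · exact LinearMap.range_le_ker_iff.mpr (bdry_comp_bdry n)
end

section
/- Fix n ≥ 0 and polynomials P_1, …, P_n ∈ F_2[x_1, …, x_n] over the field with two elements. Let B be the commutative F_2-algebra F_2[t, u_1, …, u_n, v_1, …, v_n]/I, where I is the ideal generated by the n elements v_i² − P_i(u_1, …, u_n) − t·Σ_{j=1}^{n} (∂P_i/∂x_j)(u_1, …, u_n)·v_j for 1 ≤ i ≤ n, with ∂/∂x_j the formal partial derivative. Then the image of t in B is a non-zerodivisor, and for every i ≥ 0 multiplication by t^i induces an F_2-linear isomorphism B/(t) → (t^i)B/(t^{i+1})B; that is, the associated graded ring of B with respect to the filtration by powers of the ideal (t) is the polynomial ring over B/(t) in one variable. -/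
open MvPolynomial

set_option synthInstance.maxHeartbeats 1000000
set_option maxHeartbeats 1000000

/-- Variables of the ambient polynomial ring: `none` is `t`, `some (inl i)` is `u_i`,
`some (inr i)` is `v_i`. -/
abbrev twVar (n : ℕ) : Type := Option (Fin n ⊕ Fin n)

/-- The ambient polynomial ring `F₂[t, u₁, …, u_n, v₁, …, v_n]`. -/
noncomputable abbrev twAmbient (n : ℕ) : Type := MvPolynomial (twVar n) (ZMod 2)

/-- Evaluation of a polynomial in `x₁, …, x_n` at `u₁, …, u_n`. -/
noncomputable def uSubst (n : ℕ) :
    MvPolynomial (Fin n) (ZMod 2) →ₐ[ZMod 2] twAmbient n :=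
  MvPolynomial.aeval fun j => MvPolynomial.X (some (Sum.inl j))

/-- The generator `v_i² − P_i(u) − t·Σ_j (∂P_i/∂x_j)(u)·v_j` of the defining ideal. -/
noncomputable def twGen (n : ℕ) (P : Fin n → MvPolynomial (Fin n) (ZMod 2)) (i : Fin n) :
    twAmbient n :=
  MvPolynomial.X (some (Sum.inr i)) ^ 2 - uSubst n (P i) -
    MvPolynomial.X none *
      ∑ j : Fin n, uSubst n (MvPolynomial.pderiv j (P i)) * MvPolynomial.X (some (Sum.inr j))

/-- The defining ideal `I` of the twisted algebra. -/
noncomputable def twIdeal (n : ℕ) (P : Fin n → MvPolynomial (Fin n) (ZMod 2)) :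
    Ideal (twAmbient n) :=
  Ideal.span (Set.range (twGen n P))

/-- The twisted algebra `B = F₂[t, u, v]/I` (`Ω_tw(A)` of the paper). -/
noncomputable abbrev twAlg (n : ℕ) (P : Fin n → MvPolynomial (Fin n) (ZMod 2)) : Type :=
  twAmbient n ⧸ twIdeal n P

/-- If `a` is a non-zerodivisor modulo `J` and `r` is a non-zerodivisor modulo `(a) + J`,
then `a` is a non-zerodivisor modulo `J + (r)`. -/
theorem mem_span_insert_of_mul_mem {R : Type*} [CommRing R] {a r : R} {S : Set R}
    (ha : ∀ g, a * g ∈ Ideal.span S → g ∈ Ideal.span S)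
    (hr : ∀ g, g * r ∈ Ideal.span (insert a S) → g ∈ Ideal.span (insert a S))
    {g : R} (hg : a * g ∈ Ideal.span (insert r S)) : g ∈ Ideal.span (insert r S) := by
  obtain ⟨c, h, hh, hc⟩ := Ideal.mem_span_insert.1 hg
  have hcr : c * r ∈ Ideal.span (insert a S) :=
    Ideal.mem_span_insert.2 ⟨g, -h, neg_mem hh, by linear_combination -hc⟩
  obtain ⟨b, h', hh', rfl⟩ := Ideal.mem_span_insert.1 (hr c hcr)
  refine Ideal.mem_span_insert.2 ⟨b, g - b * r, ha _ ?_, by ring⟩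
  have : a * (g - b * r) = h + h' * r := by linear_combination hc
  rw [this]
  exact add_mem hh (Ideal.mul_mem_right _ _ hh')

/-- For `k ∉ s`, the generator `twGen n P k` is a non-zerodivisor modulo the ideal generated by
`t` and the generators indexed by `s`: modulo that ideal it is a monic quadratic polynomial
in the variable `v_k`, which does not occur in the other relations. -/
theorem mem_of_mul_twGen_mem (n : ℕ) (P : Fin n → MvPolynomial (Fin n) (ZMod 2))
    {s : Finset (Fin n)} {k : Fin n} (hk : k ∉ s) (g : twAmbient n)
    (hg : g * twGen n P k ∈ Ideal.span (insert (X none) (twGen n P '' s))) :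
    g ∈ Ideal.span (insert (X none) (twGen n P '' s)) := by
  set K : Ideal (twAmbient n) := Ideal.span (insert (X none) (twGen n P '' s)) with hK
  let π : twAmbient n →ₐ[ZMod 2] twAmbient n ⧸ K := Ideal.Quotient.mkₐ (ZMod 2) K
  let ψ : twAmbient n →ₐ[ZMod 2] Polynomial (twAmbient n ⧸ K) :=
    aeval (Function.update (fun x => Polynomial.C (π (X x))) (some (Sum.inr k)) Polynomial.X)
  have hπ : ∀ f, π f = 0 ↔ f ∈ K := fun f => Ideal.Quotient.eq_zero_iff_mem
  have ht : π (X none) = 0 := (hπ _).2 (Ideal.subset_span (Set.mem_insert _ _))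
  have hψX : ∀ x, x ≠ some (Sum.inr k) → ψ (X x) = Polynomial.C (π (X x)) := fun x hx => by
    simp [ψ, Function.update_of_ne hx]
  have hψk : ψ (X (some (Sum.inr k))) = Polynomial.X := by simp [ψ]
  have hψt : ψ (X none) = 0 := by rw [hψX _ (by simp), ht, map_zero]
  have hψu : ∀ p, ψ (uSubst n p) = Polynomial.C (π (uSubst n p)) := fun p => by
    have : ψ.comp (uSubst n) = (Polynomial.CAlgHom.comp π).comp (uSubst n) := by
      refine MvPolynomial.algHom_ext fun j => ?_
      simpa [uSubst] using hψX (some (Sum.inl j)) (by simp)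
    exact DFunLike.congr_fun this p
  have hψK : K ≤ RingHom.ker ψ := by
    refine Ideal.span_le.2 ?_
    rintro _ (rfl | ⟨i, hi, rfl⟩)
    · exact hψt
    · have hik : i ≠ k := fun h => hk (h ▸ hi)
      have h0 : π (twGen n P i) = 0 :=
        (hπ _).2 (Ideal.subset_span (Set.mem_insert_of_mem _ ⟨i, hi, rfl⟩))
      change ψ (twGen n P i) = 0
      rw [twGen, map_sub, map_sub, map_mul, ht, zero_mul, sub_zero, map_pow] at h0
      rw [twGen, map_sub, map_sub, map_mul, hψt, zero_mul, sub_zero, map_pow, hψu,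
        hψX _ (by simpa using hik), ← map_pow, ← map_sub, h0, map_zero]
  have hψr : ψ (twGen n P k) = Polynomial.X ^ 2 - Polynomial.C (π (uSubst n (P k))) := by
    rw [twGen, map_sub, map_sub, map_mul, hψt, zero_mul, sub_zero, map_pow, hψu, hψk]
  have hψg : ψ g = 0 := by
    have h : ψ (g * twGen n P k) = 0 := hψK hg
    rw [map_mul, hψr] at h
    exact ((Polynomial.monic_X_pow_sub_C _ two_ne_zero).mul_left_eq_zero_iff).1 h
  have hev : ∀ f, Polynomial.eval (π (X (some (Sum.inr k)))) (ψ f) = π f := fun f => by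
    have : ((Polynomial.aeval (R := twAmbient n ⧸ K)
        (π (X (some (Sum.inr k))))).restrictScalars (ZMod 2)).comp ψ = π := by
      refine MvPolynomial.algHom_ext fun x => ?_
      by_cases hx : x = some (Sum.inr k)
      · subst hx
        simp [hψk]
      · simp [hψX x hx]
    simpa [Polynomial.aeval_def] using DFunLike.congr_fun this f
  rw [← hπ, ← hev, hψg, Polynomial.eval_zero]

/-- The variable `t` is a non-zerodivisor modulo any subfamily of the defining relations. -/
theorem mem_of_X_none_mul_mem (n : ℕ) (P : Fin n → MvPolynomial (Fin n) (ZMod 2))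
    (s : Finset (Fin n)) (g : twAmbient n)
    (hg : X none * g ∈ Ideal.span (twGen n P '' s)) : g ∈ Ideal.span (twGen n P '' s) := by
  induction s using Finset.induction_on generalizing g with
  | empty => simpa using hg
  | insert k s hk ih =>
    rw [Finset.coe_insert, Set.image_insert_eq] at hg ⊢
    exact mem_span_insert_of_mul_mem ih (mem_of_mul_twGen_mem n P hk) hg

/-- The image `τ` of `t` in `B` is a non-zerodivisor, and for every
`i ≥ 0` multiplication by `t^i` induces an `F₂`-linear isomorphism
`B/(t) → (t^i)B/(t^{i+1})B`; concretely: the induced map is injective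
(`t^i·b ∈ (t^{i+1}) ↔ b ∈ (t)`) and surjective (every `c ∈ (t^i)` is congruent to some
`t^i·b` modulo `(t^{i+1})`).  That is, the associated graded ring of `B` for the
filtration by powers of `(t)` is the polynomial ring over `B/(t)` in one variable. -/
theorem stmt10 (n : ℕ) (P : Fin n → MvPolynomial (Fin n) (ZMod 2)) :
    letI τ : twAlg n P := Ideal.Quotient.mk (twIdeal n P) (MvPolynomial.X none)
    τ ∈ nonZeroDivisors (twAlg n P) ∧
    (∀ (i : ℕ) (b : twAlg n P),
      τ ^ i * b ∈ Ideal.span {τ ^ (i + 1)} ↔ b ∈ Ideal.span {τ}) ∧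
    (∀ (i : ℕ), ∀ c ∈ Ideal.span {τ ^ i},
      ∃ b : twAlg n P, c - τ ^ i * b ∈ Ideal.span {τ ^ (i + 1)}) := by
  have hτ : (Ideal.Quotient.mk (twIdeal n P) (X none) : twAlg n P) ∈
      nonZeroDivisors (twAlg n P) := by
    refine mem_nonZeroDivisors_iff_left.2 fun b hb => ?_
    obtain ⟨g, rfl⟩ := Ideal.Quotient.mk_surjective b
    rw [← map_mul, Ideal.Quotient.eq_zero_iff_mem] at hb
    rw [Ideal.Quotient.eq_zero_iff_mem]
    have h := mem_of_X_none_mul_mem n P Finset.univ g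
    rw [Finset.coe_univ, Set.image_univ] at h
    exact h hb
  refine ⟨hτ, fun i b => ?_, fun i c hc => ?_⟩
  · rw [Ideal.mem_span_singleton, Ideal.mem_span_singleton, pow_succ]
    refine ⟨fun ⟨d, hd⟩ => ⟨d, ?_⟩, mul_dvd_mul_left _⟩
    rw [mul_assoc] at hd
    exact (mul_cancel_left_mem_nonZeroDivisors (pow_mem hτ i)).1 hd
  · obtain ⟨b, rfl⟩ := Ideal.mem_span_singleton.1 hc
    exact ⟨b, by simp⟩
end
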